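/- (Theorem 5: safety of the adaptive robot controller.) In addition to the hypotheses and notation of Lemma 1 (so that V′(t) ≤ −k‖s(t)‖² − (β/2)‖ν̃(t)‖²), let h : ℝⁿ → ℝ be continuously differentiable, let q : [0, T) → ℝⁿ be differentiable with q̇(t) = s(t) + r(t) where r : [0, T) → ℝⁿ is the reference velocity along the trajectory, and let α, μ, ε, λ, M̄ > 0 and ϑ̃ : [0, T) → ℝᵖ satisfy, for all t ∈ [0, T): (i) zᵀ Γ z ≥ λ‖z‖² for all z ∈ ℝᵖ; (ii) zᵀ M(t) z ≤ M̄ ‖z‖² for all z ∈ ℝⁿ; (iii) the weighted error bound (θ − ν(t))ᵀ Γ⁻¹ (θ − ν(t)) ≤ ϑ̃(t)ᵀ Γ⁻¹ ϑ̃(t); (iv) the safe reference velocity condition ∇h(q(t)) ⋅ r(t) ≥ −α[ h(q(t)) − (1/(2μ)) ϑ̃(t)ᵀ Γ⁻¹ ϑ̃(t) ] + (1/ε) ‖∇h(q(t))‖²; (v) the gain conditions β ≥ α/λ and k ≥ max{ εμ/2, α M̄ }. Define B(t) := h(q(t)) − V(t)/μ. If B(0) ≥ 0, then B(t) ≥ 0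 and h(q(t)) ≥ 0 for all t ∈ [0, T). -/

import Mathlib

open Matrix

/-- Gradient of `h : ℝⁿ → ℝ` as a vector. -/
noncomputable def gradVec {n : ℕ} (h : (Fin n → ℝ) → ℝ) (x : Fin n → ℝ) : Fin n → ℝ :=
  fun i => fderiv ℝ h x (Pi.single i 1)

/-- Lyapunov-like function
`V := ½ (sᵀ M s + (θ - ν)ᵀ Γ⁻¹ (θ - ν) + (ν - θ̂)ᵀ Γ⁻¹ (ν - θ̂))` along a trajectory. -/
noncomputable def Vfun {n p : ℕ} (θ : Fin p → ℝ) (Γ : Matrix (Fin p) (Fin p) ℝ)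
    (M : ℝ → Matrix (Fin n) (Fin n) ℝ) (s : ℝ → Fin n → ℝ)
    (ν θhat : ℝ → Fin p → ℝ) (t : ℝ) : ℝ :=
  (1 / 2) * (s t ⬝ᵥ (M t *ᵥ s t)
    + (θ - ν t) ⬝ᵥ (Γ⁻¹ *ᵥ (θ - ν t))
    + (ν t - θhat t) ⬝ᵥ (Γ⁻¹ *ᵥ (ν t - θhat t)))

theorem HasDerivAt.dotProduct' {m : ℕ} {x y : ℝ → Fin m → ℝ} {x' y' : Fin m → ℝ} {t : ℝ}
    (hx : HasDerivAt x x' t) (hy : HasDerivAt y y' t) :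
    HasDerivAt (fun τ => x τ ⬝ᵥ y τ) (x' ⬝ᵥ y t + x t ⬝ᵥ y') t := by
  rw [hasDerivAt_pi] at hx hy
  simp only [dotProduct, ← Finset.sum_add_distrib]
  exact HasDerivAt.fun_sum fun i _ => (hx i).mul (hy i)

theorem HasDerivAt.mulVec' {m l : ℕ} {A : ℝ → Matrix (Fin m) (Fin l) ℝ}
    {A' : Matrix (Fin m) (Fin l) ℝ} {x : ℝ → Fin l → ℝ} {x' : Fin l → ℝ} {t : ℝ}
    (hA : ∀ i j, HasDerivAt (fun τ => A τ i j) (A' i j) t) (hx : HasDerivAt x x' t) :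
    HasDerivAt (fun τ => A τ *ᵥ x τ) (A' *ᵥ x t + A t *ᵥ x') t := by
  rw [hasDerivAt_pi]
  exact fun i => HasDerivAt.dotProduct' (hasDerivAt_pi.2 (hA i)) hx

theorem Matrix.IsHermitian.dotProduct_mulVec_comm_real {m : ℕ} {A : Matrix (Fin m) (Fin m) ℝ}
    (hA : A.IsHermitian) (x y : Fin m → ℝ) : x ⬝ᵥ (A *ᵥ y) = y ⬝ᵥ (A *ᵥ x) := by
  have hT : Aᵀ = A := by simpa [Matrix.IsHermitian, conjTranspose_eq_transpose_of_trivial] using hA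
  rw [dotProduct_mulVec, ← mulVec_transpose, hT, dotProduct_comm]

/-- Derivative of the quadratic form `xᵀ A x` along a curve, for constant symmetric `A`. -/
theorem HasDerivAt.quadForm {m : ℕ} {A : Matrix (Fin m) (Fin m) ℝ} (hA : A.IsHermitian)
    {x : ℝ → Fin m → ℝ} {x' : Fin m → ℝ} {t : ℝ} (hx : HasDerivAt x x' t) :
    HasDerivAt (fun τ => x τ ⬝ᵥ (A *ᵥ x τ)) (2 * (x t ⬝ᵥ (A *ᵥ x'))) t := by
  have h := hx.dotProduct' (HasDerivAt.mulVec' (A := fun _ => A) (A' := 0)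
    (fun i j => by simpa using hasDerivAt_const t (A i j)) hx)
  refine h.congr_deriv ?_
  rw [zero_mulVec, zero_add, hA.dotProduct_mulVec_comm_real x']
  ring

theorem gradVec_dotProduct {n : ℕ} (h : (Fin n → ℝ) → ℝ) (x v : Fin n → ℝ) :
    gradVec h x ⬝ᵥ v = fderiv ℝ h x v := by
  conv_rhs => rw [pi_eq_sum_univ' v]
  simp only [map_sum, map_smul, dotProduct, gradVec, smul_eq_mul]
  refine Finset.sum_congr rfl fun i _ => ?_
  exact mul_comm _ _

/-- If `zᵀ Γ z ≥ lam ‖z‖²` then `zᵀ Γ⁻¹ z ≤ ‖z‖² / lam`. -/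
theorem Matrix.PosDef.mul_dotProduct_inv_mulVec_le {p : ℕ} {Γ : Matrix (Fin p) (Fin p) ℝ}
    (hΓ : Γ.PosDef) {lam : ℝ} (hlam : 0 < lam)
    (hlow : ∀ z : Fin p → ℝ, z ⬝ᵥ (Γ *ᵥ z) ≥ lam * (z ⬝ᵥ z)) (z : Fin p → ℝ) :
    lam * (z ⬝ᵥ (Γ⁻¹ *ᵥ z)) ≤ z ⬝ᵥ z := by
  have hdet : IsUnit Γ.det := hΓ.det_pos.ne'.isUnit
  set y := Γ⁻¹ *ᵥ z with hy
  have hz : Γ *ᵥ y = z := by rw [hy, mulVec_mulVec, mul_nonsing_inv _ hdet, one_mulVec]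
  have h1 := hlow y
  rw [hz, dotProduct_comm y z] at h1
  have h2 : 0 ≤ (z - lam • y) ⬝ᵥ (z - lam • y) :=
    Finset.sum_nonneg fun i _ => mul_self_nonneg _
  simp only [sub_dotProduct, dotProduct_sub, smul_dotProduct, dotProduct_smul, smul_eq_mul,
    dotProduct_comm y z] at h2
  nlinarith

/-- Decay of the Lyapunov-like function: its derivative exists and is at most
`-k ‖s‖² - (β / 2) ‖ν - θhat‖²`. -/
theorem hasDerivAt_Vfun_le {n p : ℕ} {θ : Fin p → ℝ} {β : ℝ} (hβ : 0 < β)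
    {Γ : Matrix (Fin p) (Fin p) ℝ} (hΓ : Γ.PosDef)
    {K : Matrix (Fin n) (Fin n) ℝ} {k : ℝ}
    (hK : ∀ z : Fin n → ℝ, z ⬝ᵥ (K *ᵥ z) ≥ k * (z ⬝ᵥ z))
    {M : ℝ → Matrix (Fin n) (Fin n) ℝ} {M' C : Matrix (Fin n) (Fin n) ℝ}
    {W : Matrix (Fin n) (Fin p) ℝ}
    {s : ℝ → Fin n → ℝ} {s' : Fin n → ℝ} {ν θhat : ℝ → Fin p → ℝ} {u : Fin n → ℝ} {t : ℝ}
    (hMpd : (M t).PosDef)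
    (hM : ∀ i j, HasDerivAt (fun τ => M τ i j) (M' i j) t)
    (hskew : ∀ z : Fin n → ℝ, z ⬝ᵥ ((((1 : ℝ) / 2) • M' - C) *ᵥ z) = 0)
    (hu : u = -(K *ᵥ s t) + W *ᵥ θhat t - (2 / β) • (W *ᵥ (Wᵀ *ᵥ s t)))
    (hs : HasDerivAt s s' t)
    (hsdyn : M t *ᵥ s' = u - W *ᵥ θ - C *ᵥ s t)
    (hν : HasDerivAt ν (-(Γ *ᵥ (Wᵀ *ᵥ s t))) t)
    (hθhat : HasDerivAt θhat (β • (Γ *ᵥ (ν t - θhat t))) t) :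
    ∃ V', HasDerivAt (Vfun θ Γ M s ν θhat) V' t ∧
      V' ≤ -k * (s t ⬝ᵥ s t) - (β / 2) * ((ν t - θhat t) ⬝ᵥ (ν t - θhat t)) := by
  have hdet : IsUnit Γ.det := hΓ.det_pos.ne'.isUnit
  have hinv : ∀ z, Γ⁻¹ *ᵥ (Γ *ᵥ z) = z := fun z => by
    rw [mulVec_mulVec, nonsing_inv_mul _ hdet, one_mulVec]
  have d1 := hs.dotProduct' (HasDerivAt.mulVec' hM hs)
  have d2 := HasDerivAt.quadForm hΓ.inv.isHermitian (hν.const_sub θ)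
  have d3 := HasDerivAt.quadForm hΓ.inv.isHermitian (hν.fun_sub hθhat)
  refine ⟨_, ((d1.fun_add d2).fun_add d3).const_mul (1 / 2), ?_⟩
  set w := Wᵀ *ᵥ s t with hw
  have hW : ∀ z, s t ⬝ᵥ (W *ᵥ z) = w ⬝ᵥ z := fun z => by
    rw [dotProduct_mulVec, hw, mulVec_transpose]
  have hsk := hskew (s t)
  have hKs := hK (s t)
  rw [sub_mulVec, smul_mulVec, dotProduct_sub, dotProduct_smul, smul_eq_mul] at hsk
  rw [hMpd.isHermitian.dotProduct_mulVec_comm_real s', dotProduct_add, hsdyn, hu]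
  simp only [neg_neg, mulVec_sub, mulVec_neg, mulVec_smul, hinv, dotProduct_sub, dotProduct_add,
    dotProduct_neg, dotProduct_smul, smul_eq_mul, hW]
  have hsq : 0 ≤ ((2 / β) • w + (ν t - θhat t)) ⬝ᵥ ((2 / β) • w + (ν t - θhat t)) :=
    Finset.sum_nonneg fun i _ => mul_self_nonneg _
  have hsq' := mul_nonneg (half_pos hβ).le hsq
  simp only [add_dotProduct, sub_dotProduct, dotProduct_sub, dotProduct_add, smul_dotProduct,
    dotProduct_smul, smul_eq_mul, dotProduct_comm _ w, dotProduct_comm (θhat t) (ν t)] at hsq' ⊢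
  have e : β / 2 * (2 / β) = 1 := by field_simp
  have e' : β / 2 * ((2 / β) * (2 / β * (w ⬝ᵥ w))) = 2 / β * (w ⬝ᵥ w) := by field_simp
  have e2 : ∀ x, β / 2 * ((2 / β) * x) = x := fun x => by field_simp
  simp only [mul_add, mul_sub, e'] at hsq' ⊢
  simp only [e2] at hsq'
  linarith

/-- A function with `B' ≥ -α B` on `[0, t]` that starts nonnegative stays nonnegative. -/
theorem nonneg_of_hasDerivAt_ge_neg_mul {B B' : ℝ → ℝ} {α t : ℝ} (ht : 0 ≤ t)
    (hB : ∀ τ ∈ Set.Icc 0 t, HasDerivAt B (B' τ) τ)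
    (hle : ∀ τ ∈ Set.Icc 0 t, -α * B τ ≤ B' τ) (h0 : 0 ≤ B 0) : 0 ≤ B t := by
  have hd : ∀ τ ∈ Set.Icc 0 t, HasDerivAt (fun τ => Real.exp (α * τ) * B τ)
      (Real.exp (α * τ) * (α * B τ + B' τ)) τ := fun τ hτ => by
    have h := (((hasDerivAt_id τ).const_mul α).exp).fun_mul (hB τ hτ)
    refine h.congr_deriv ?_
    simp only [id]
    ring
  have hmono : MonotoneOn (fun τ => Real.exp (α * τ) * B τ) (Set.Icc 0 t) := by
    refine monotoneOn_of_hasDerivWithinAt_nonneg (convex_Icc 0 t)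
      (fun τ hτ => (hd τ hτ).continuousAt.continuousWithinAt)
      (fun τ hτ => (hd τ (interior_subset hτ)).hasDerivWithinAt) fun τ hτ => ?_
    have := hle τ (interior_subset hτ)
    exact mul_nonneg (Real.exp_pos _).le (by linarith)
  have h := hmono (Set.left_mem_Icc.2 ht) (Set.right_mem_Icc.2 ht) ht
  simp only [mul_zero, Real.exp_zero, one_mul] at h
  exact nonneg_of_mul_nonneg_right (h0.trans h) (Real.exp_pos _)

theorem Vfun_nonneg {n p : ℕ} (θ : Fin p → ℝ) {Γ : Matrix (Fin p) (Fin p) ℝ} (hΓ : Γ.PosDef)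
    {M : ℝ → Matrix (Fin n) (Fin n) ℝ} (s : ℝ → Fin n → ℝ) (ν θhat : ℝ → Fin p → ℝ) {t : ℝ}
    (hM : (M t).PosDef) : 0 ≤ Vfun θ Γ M s ν θhat t := by
  have h1 := hM.posSemidef.dotProduct_mulVec_nonneg (s t)
  have h2 := hΓ.inv.posSemidef.dotProduct_mulVec_nonneg (θ - ν t)
  have h3 := hΓ.inv.posSemidef.dotProduct_mulVec_nonneg (ν t - θhat t)
  simp only [star_trivial] at h1 h2 h3
  unfold Vfun
  linarith

/-- Theorem 5: safety of the adaptive robot controller: under the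
hypotheses of Lemma 1 together with the safe-reference-velocity condition, the
weighted intermediate-error bound, the inertia bound `zᵀ M z ≤ M̄ ‖z‖²`, the gain
conditions `β ≥ α/λ` and `k ≥ max (εμ/2) (α M̄)`, the auxiliary barrier
`B := h(q) - V/μ` remains nonnegative if it starts nonnegative, and hence
`h (q t) ≥ 0`. -/
theorem stmt_12 {n p : ℕ} (θ : Fin p → ℝ) (β : ℝ) (hβ : 0 < β)
    (Γ : Matrix (Fin p) (Fin p) ℝ) (hΓ : Γ.PosDef)
    (K : Matrix (Fin n) (Fin n) ℝ) (k : ℝ) (hk : 0 < k)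
    (hK : ∀ z : Fin n → ℝ, z ⬝ᵥ (K *ᵥ z) ≥ k * (z ⬝ᵥ z))
    (T : EReal) (hT : 0 < T)
    (M M' : ℝ → Matrix (Fin n) (Fin n) ℝ) (C : ℝ → Matrix (Fin n) (Fin n) ℝ)
    (W : ℝ → Matrix (Fin n) (Fin p) ℝ)
    (s s' : ℝ → Fin n → ℝ) (ν θhat : ℝ → Fin p → ℝ) (u : ℝ → Fin n → ℝ)
    (hMpd : ∀ t : ℝ, 0 ≤ t → (t : EReal) < T → (M t).PosDef)
    (hMderiv : ∀ t : ℝ, 0 ≤ t → (t : EReal) < T → ∀ i j : Fin n,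
      HasDerivAt (fun τ => M τ i j) (M' t i j) t)
    (hskew : ∀ t : ℝ, 0 ≤ t → (t : EReal) < T → ∀ z : Fin n → ℝ,
      z ⬝ᵥ ((((1 : ℝ) / 2) • M' t - C t) *ᵥ z) = 0)
    (hu : ∀ t : ℝ, 0 ≤ t → (t : EReal) < T →
      u t = -(K *ᵥ s t) + W t *ᵥ θhat t - (2 / β) • (W t *ᵥ ((W t)ᵀ *ᵥ s t)))
    (hs : ∀ t : ℝ, 0 ≤ t → (t : EReal) < T → HasDerivAt s (s' t) t)
    (hsdyn : ∀ t : ℝ, 0 ≤ t → (t : EReal) < T →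
      M t *ᵥ s' t = u t - W t *ᵥ θ - C t *ᵥ s t)
    (hν : ∀ t : ℝ, 0 ≤ t → (t : EReal) < T →
      HasDerivAt ν (-(Γ *ᵥ ((W t)ᵀ *ᵥ s t))) t)
    (hθhat : ∀ t : ℝ, 0 ≤ t → (t : EReal) < T →
      HasDerivAt θhat (β • (Γ *ᵥ (ν t - θhat t))) t)
    -- additional hypotheses of Theorem 5
    (h : (Fin n → ℝ) → ℝ) (hh : ContDiff ℝ 1 h)
    (q r : ℝ → Fin n → ℝ)
    (hq : ∀ t : ℝ, 0 ≤ t → (t : EReal) < T → HasDerivAt q (s t + r t) t)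
    (α μ ε lam Mbar : ℝ)
    (hα : 0 < α) (hμ : 0 < μ) (hε : 0 < ε) (hlam : 0 < lam) (hMbar : 0 < Mbar)
    (ϑ : ℝ → Fin p → ℝ)
    (hΓlow : ∀ z : Fin p → ℝ, z ⬝ᵥ (Γ *ᵥ z) ≥ lam * (z ⬝ᵥ z))
    (hMup : ∀ t : ℝ, 0 ≤ t → (t : EReal) < T → ∀ z : Fin n → ℝ,
      z ⬝ᵥ (M t *ᵥ z) ≤ Mbar * (z ⬝ᵥ z))
    (herr : ∀ t : ℝ, 0 ≤ t → (t : EReal) < T →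
      (θ - ν t) ⬝ᵥ (Γ⁻¹ *ᵥ (θ - ν t)) ≤ ϑ t ⬝ᵥ (Γ⁻¹ *ᵥ ϑ t))
    (href : ∀ t : ℝ, 0 ≤ t → (t : EReal) < T →
      gradVec h (q t) ⬝ᵥ r t ≥
        -α * (h (q t) - (1 / (2 * μ)) * (ϑ t ⬝ᵥ (Γ⁻¹ *ᵥ ϑ t)))
          + (1 / ε) * (gradVec h (q t) ⬝ᵥ gradVec h (q t)))
    (hβα : β ≥ α / lam)
    (hkcond : k ≥ max (ε * μ / 2) (α * Mbar))
    (hB0 : h (q 0) - Vfun θ Γ M s ν θhat 0 / μ ≥ 0) :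
    ∀ t : ℝ, 0 ≤ t → (t : EReal) < T →
      h (q t) - Vfun θ Γ M s ν θhat t / μ ≥ 0 ∧ h (q t) ≥ 0 := by
  intro t ht htT
  have hlt : ∀ τ ∈ Set.Icc 0 t, (τ : EReal) < T := fun τ hτ =>
    (EReal.coe_le_coe_iff.2 hτ.2).trans_lt htT
  have hder : ∀ τ ∈ Set.Icc 0 t, ∃ B',
      HasDerivAt (fun τ => h (q τ) - Vfun θ Γ M s ν θhat τ / μ) B' τ ∧
        -α * (h (q τ) - Vfun θ Γ M s ν θhat τ / μ) ≤ B' := by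
    intro τ hτ
    have h0 := hτ.1
    have h1 := hlt τ hτ
    obtain ⟨V', hV, hV'⟩ := hasDerivAt_Vfun_le hβ hΓ hK (hMpd τ h0 h1) (hMderiv τ h0 h1)
      (hskew τ h0 h1) (hu τ h0 h1) (hs τ h0 h1) (hsdyn τ h0 h1) (hν τ h0 h1) (hθhat τ h0 h1)
    have hhq := ((hh.differentiable one_ne_zero) (q τ)).hasFDerivAt.comp_hasDerivAt τ (hq τ h0 h1)
    refine ⟨_, hhq.fun_sub (hV.div_const μ), ?_⟩
    rw [← gradVec_dotProduct, dotProduct_add]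
    have hr := href τ h0 h1
    have he := herr τ h0 h1
    have hm := hMup τ h0 h1 (s τ)
    have hz := hΓ.mul_dotProduct_inv_mulVec_le hlam hΓlow (ν τ - θhat τ)
    have hsq : 0 ≤ (gradVec h (q τ) + (ε / 2) • s τ) ⬝ᵥ (gradVec h (q τ) + (ε / 2) • s τ) :=
      Finset.sum_nonneg fun i _ => mul_self_nonneg _
    simp only [add_dotProduct, dotProduct_add, smul_dotProduct, dotProduct_smul, smul_eq_mul,
      dotProduct_comm (s τ) (gradVec h (q τ))] at hsq
    have hss : 0 ≤ s τ ⬝ᵥ s τ := Finset.sum_nonneg fun i _ => mul_self_nonneg _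
    have hnn : 0 ≤ (ν τ - θhat τ) ⬝ᵥ (ν τ - θhat τ) :=
      Finset.sum_nonneg fun i _ => mul_self_nonneg _
    have hk1 : ε * μ / 2 ≤ k := (le_max_left _ _).trans hkcond
    have hk2 : α * Mbar ≤ k := (le_max_right _ _).trans hkcond
    unfold Vfun
    set G := gradVec h (q τ)
    set S := s τ ⬝ᵥ s τ
    set N := (ν τ - θhat τ) ⬝ᵥ (ν τ - θhat τ)
    set E := (ν τ - θhat τ) ⬝ᵥ (Γ⁻¹ *ᵥ (ν τ - θhat τ))
    set D := (θ - ν τ) ⬝ᵥ (Γ⁻¹ *ᵥ (θ - ν τ))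
    set P := ϑ τ ⬝ᵥ (Γ⁻¹ *ᵥ ϑ τ)
    set Q := s τ ⬝ᵥ (M τ *ᵥ s τ)
    have hE : α * E ≤ β * N := by
      have hEN : E ≤ N / lam := (le_div_iff₀' hlam).2 hz
      calc α * E ≤ α * (N / lam) := by gcongr
        _ = α / lam * N := by ring
        _ ≤ β * N := by gcongr
    have hQ : α * Q ≤ k * S := by
      calc α * Q ≤ α * (Mbar * S) := by gcongr
        _ = α * Mbar * S := by ring
        _ ≤ k * S := by gcongr
    have hD : α * D ≤ α * P := by gcongr
    have hkS : ε * μ / 2 * S ≤ k * S := by gcongr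
    have hG : 0 ≤ (1 / ε) * (G ⬝ᵥ G) + G ⬝ᵥ s τ + ε / 4 * S := by
      have := mul_nonneg (one_div_pos.2 hε).le hsq
      refine this.trans_eq ?_
      field_simp
      ring
    have hV2 : V' / μ ≤ -(ε / 4 * S) - (α * Q + α * D + α * E) / (2 * μ) + α * P / (2 * μ) := by
      rw [div_le_iff₀ hμ]
      have e : (-(ε / 4 * S) - (α * Q + α * D + α * E) / (2 * μ) + α * P / (2 * μ)) * μ
          = -(ε * μ / 4 * S) - (α * Q + α * D + α * E) / 2 + α * P / 2 := by
        field_simp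
      rw [e]
      linarith
    have e1 : -α * (h (q τ) - 1 / 2 * (Q + D + E) / μ)
        = -α * h (q τ) + (α * Q + α * D + α * E) / (2 * μ) := by
      field_simp
      ring
    have e2 : -α * (h (q τ) - 1 / (2 * μ) * P) = -α * h (q τ) + α * P / (2 * μ) := by
      field_simp
      ring
    rw [e1]
    rw [e2] at hr
    linarith
  choose! B' hB' hle using hder
  have hBt : 0 ≤ h (q t) - Vfun θ Γ M s ν θhat t / μ :=
    nonneg_of_hasDerivAt_ge_neg_mul (B := fun τ => h (q τ) - Vfun θ Γ M s ν θhat τ / μ)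
      ht hB' hle hB0
  have hVt := div_nonneg (Vfun_nonneg θ hΓ s ν θhat (hMpd t ht htT)) hμ.le
  exact ⟨hBt, by linarith⟩
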